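/- Let 0 < a < b be real numbers, and define h(x) = arcsin(2ax/(x² + a²)) + arcsin(2bx/(x² + b²)) for a < x < b. Then h is differentiable on (a, b) with h′(x) = 2(x² − ab)(b − a)/((a² + x²)(b² + x²)), and h attains a strict global minimum on (a, b) at x = √(ab): h(√(ab)) < h(x) for all x ∈ (a, b) with x ≠ √(ab). -/

import Mathlib

open Real

theorem hasDerivAt_arcsin_two_mul_div {c x : ℝ} (hc : 0 < c) (hx : 0 < x) (hxc : x ≠ c) :
    HasDerivAt (fun y : ℝ => arcsin (2 * c * y / (y ^ 2 + c ^ 2)))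
      ((c ^ 2 - x ^ 2) / |c ^ 2 - x ^ 2| * (2 * c / (x ^ 2 + c ^ 2))) x := by
  have hpos : 0 < x ^ 2 + c ^ 2 := by positivity
  have hne : c ^ 2 - x ^ 2 ≠ 0 := by
    rw [sq_sub_sq]
    exact mul_ne_zero (by positivity) (sub_ne_zero.mpr hxc.symm)
  have hinner : HasDerivAt (fun y : ℝ => 2 * c * y / (y ^ 2 + c ^ 2))
      (2 * c * (c ^ 2 - x ^ 2) / (x ^ 2 + c ^ 2) ^ 2) x := by
    have := ((hasDerivAt_id x).const_mul (2 * c)).div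
      (((hasDerivAt_id x).pow 2).add_const (c ^ 2)) hpos.ne'
    refine this.congr_deriv ?_
    simp only [id, Pi.pow_apply]
    congr 1
    push_cast
    ring
  have hneg : 2 * c * x / (x ^ 2 + c ^ 2) ≠ -1 := by
    have : 0 < 2 * c * x / (x ^ 2 + c ^ 2) := by positivity
    linarith
  have hone : 2 * c * x / (x ^ 2 + c ^ 2) ≠ 1 := by
    rw [Ne, div_eq_one_iff_eq hpos.ne']
    intro heq
    have : (x - c) ^ 2 = 0 := by linarith
    exact hxc (sub_eq_zero.mp (pow_eq_zero_iff two_ne_zero |>.mp this))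
  have hsqrt : √(1 - (2 * c * x / (x ^ 2 + c ^ 2)) ^ 2) = |c ^ 2 - x ^ 2| / (x ^ 2 + c ^ 2) := by
    have : 1 - (2 * c * x / (x ^ 2 + c ^ 2)) ^ 2 = ((c ^ 2 - x ^ 2) / (x ^ 2 + c ^ 2)) ^ 2 := by
      field_simp
      ring
    rw [this, sqrt_sq_eq_abs, abs_div, abs_of_pos hpos]
  refine ((hasDerivAt_arcsin hneg hone).comp x hinner).congr_deriv ?_
  rw [hsqrt]
  have := abs_ne_zero.mpr hne
  field_simp

/-- For `0 < a < b`, the angle-sum function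
`h(x) = arcsin (2ax/(x²+a²)) + arcsin (2bx/(x²+b²))` on `(a, b)` has derivative
`2(x² − ab)(b − a)/((a²+x²)(b²+x²))` and attains a strict global minimum at `x = √(ab)`. -/
theorem stmt_7 (a b : ℝ) (ha : 0 < a) (hab : a < b)
    (h : ℝ → ℝ)
    (hh : ∀ x : ℝ, h x =
      arcsin (2 * a * x / (x ^ 2 + a ^ 2)) + arcsin (2 * b * x / (x ^ 2 + b ^ 2))) :
    (∀ x ∈ Set.Ioo a b,
      HasDerivAt h (2 * (x ^ 2 - a * b) * (b - a) / ((a ^ 2 + x ^ 2) * (b ^ 2 + x ^ 2))) x) ∧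
    (∀ x ∈ Set.Ioo a b, x ≠ Real.sqrt (a * b) → h (Real.sqrt (a * b)) < h x) := by
  have hb : 0 < b := ha.trans hab
  have hderiv : ∀ x ∈ Set.Ioo a b, HasDerivAt h
      (2 * (x ^ 2 - a * b) * (b - a) / ((a ^ 2 + x ^ 2) * (b ^ 2 + x ^ 2))) x := by
    rintro x ⟨hax, hxb⟩
    have hx : 0 < x := ha.trans hax
    rw [funext hh]
    refine ((hasDerivAt_arcsin_two_mul_div ha hx hax.ne').add
      (hasDerivAt_arcsin_two_mul_div hb hx hxb.ne)).congr_deriv ?_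
    have h1 : a ^ 2 - x ^ 2 < 0 := by nlinarith
    have h2 : 0 < b ^ 2 - x ^ 2 := by nlinarith
    rw [abs_of_neg h1, abs_of_pos h2, div_neg, div_self h1.ne, div_self h2.ne']
    field_simp
    ring
  refine ⟨hderiv, ?_⟩
  rintro x ⟨hax, hxb⟩ hne
  have hm : √(a * b) ∈ Set.Ioo a b :=
    ⟨lt_sqrt_of_sq_lt (by nlinarith), (sqrt_lt' hb).mpr (by nlinarith)⟩
  rcases lt_or_gt_of_ne hne with hlt | hgt
  · have hsub : Set.Icc x √(a * b) ⊆ Set.Ioo a b := Set.Icc_subset_Ioo hax hm.2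
    refine strictAntiOn_of_deriv_neg (convex_Icc x √(a * b))
      (fun y hy => (hderiv y (hsub hy)).continuousAt.continuousWithinAt) (fun y hy => ?_)
      (Set.left_mem_Icc.mpr hlt.le) (Set.right_mem_Icc.mpr hlt.le) hlt
    have hy' := hsub (interior_subset hy)
    rw [interior_Icc] at hy
    rw [(hderiv y hy').deriv]
    have hy0 : 0 < y := ha.trans hy'.1
    have : y ^ 2 < a * b := (lt_sqrt hy0.le).mp hy.2
    exact div_neg_of_neg_of_pos
      (mul_neg_of_neg_of_pos (by linarith) (sub_pos.mpr hab)) (by positivity)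
  · have hsub : Set.Icc √(a * b) x ⊆ Set.Ioo a b := Set.Icc_subset_Ioo hm.1 hxb
    refine strictMonoOn_of_deriv_pos (convex_Icc √(a * b) x)
      (fun y hy => (hderiv y (hsub hy)).continuousAt.continuousWithinAt) (fun y hy => ?_)
      (Set.left_mem_Icc.mpr hgt.le) (Set.right_mem_Icc.mpr hgt.le) hgt
    have hy' := hsub (interior_subset hy)
    rw [interior_Icc] at hy
    rw [(hderiv y hy').deriv]
    have hy0 : 0 < y := ha.trans hy'.1
    have : a * b < y ^ 2 := (sqrt_lt' hy0).mp hy.1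
    exact div_pos (mul_pos (by linarith) (sub_pos.mpr hab)) (by positivity)
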